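/- arXiv:1410.2385 — 2 statements merged into one kernel-verified Lean document; each statement's English description precedes it below -/
import Mathlib

section
/- Let ξ ∈ (-1, 0). The saddle point equation with ξ₁ = ξ₂ = ξ has two distinct solutions in the segment i·(√(2c), 1/√(2c)) other than i if and only if -(1/2)√(1-2c) < ξ < 0. Moreover, when -(1/2)√(1-2c) < ξ < 0, there exists ω_c ∈ i·(√(2c), 1) such that the set of solutions of the saddle point equation in i·(√(2c), 1/√(2c)) is exactly {ω_c, -1/ω_c}, and Re g_ξ(ω_c) < 0 and Re g_ξ(-1/ω_c) > 0. -/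
/-- `c = a/(1+a²)`. -/
noncomputable def cOf (a : ℝ) : ℝ := a / (1 + a ^ 2)

/-- The branch of the logarithm with argument in `(-π/2, 3π/2]`:
`L(z) = Log(-iz) + iπ/2` where `Log` is the principal branch. -/
noncomputable def Lbr (z : ℂ) : ℂ :=
  Complex.log (-Complex.I * z) + Complex.I * ((Real.pi : ℂ) / 2)

/-- The branch `√(ω² + 2c) = exp((1/2)L(ω + i√(2c)) + (1/2)L(ω - i√(2c)))`. -/
noncomputable def sqBr (a : ℝ) (ω : ℂ) : ℂ :=
  Complex.exp ((1 / 2 : ℂ) * Lbr (ω + Complex.I * (Real.sqrt (2 * cOf a) : ℂ)) +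
    (1 / 2 : ℂ) * Lbr (ω - Complex.I * (Real.sqrt (2 * cOf a) : ℂ)))

/-- `G(ω) = (ω - √(ω² + 2c))/√(2c)`. -/
noncomputable def Gbr (a : ℝ) (ω : ℂ) : ℂ :=
  (ω - sqBr a ω) / (Real.sqrt (2 * cOf a) : ℂ)

/-- The branch cuts `𝒞 = i·((-∞, -1/√(2c)] ∪ [-√(2c), √(2c)] ∪ [1/√(2c), ∞))`. -/
def cuts (a : ℝ) : Set ℂ :=
  {z : ℂ | ∃ t : ℝ, z = Complex.I * (t : ℂ) ∧
    (t ≤ -(1 / Real.sqrt (2 * cOf a)) ∨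
      (-Real.sqrt (2 * cOf a) ≤ t ∧ t ≤ Real.sqrt (2 * cOf a)) ∨
      1 / Real.sqrt (2 * cOf a) ≤ t)}

/-- The branch of the logarithm with argument in `(0, 2π]`: `L₃(z) = Log(-z) + iπ`. -/
noncomputable def L3 (z : ℂ) : ℂ := Complex.log (-z) + Complex.I * (Real.pi : ℂ)

/-- The saddle point function `g_ξ(ω) = L(ω) - ξ·L(G(ω)) + ξ·L₃(G(1/ω))`. -/
noncomputable def gxi (a ξ : ℝ) (ω : ℂ) : ℂ :=
  Lbr ω - (ξ : ℂ) * Lbr (Gbr a ω) + (ξ : ℂ) * L3 (Gbr a ω⁻¹)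

/-- The saddle point equation `1 + ξ₁·ω/√(ω²+2c) + ξ₂/(ω·√(ω⁻²+2c)) = 0`. -/
def saddleEq (a ξ₁ ξ₂ : ℝ) (ω : ℂ) : Prop :=
  1 + (ξ₁ : ℂ) * ω / sqBr a ω + (ξ₂ : ℂ) / (ω * sqBr a ω⁻¹) = 0

/-- The real function `t/√(t²-k²) + 1/√(1-k²t²)`, to which the saddle point equation reduces on the
imaginary axis. -/
noncomputable def saddleFun (k t : ℝ) : ℝ :=
  t / √(t ^ 2 - k ^ 2) + 1 / √(1 - k ^ 2 * t ^ 2)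

/-- The real part of the saddle point function at `i t`. -/
noncomputable def reSaddle (k ξ t : ℝ) : ℝ :=
  Real.log t - ξ * Real.log ((t - √(t ^ 2 - k ^ 2)) / k) +
    ξ * Real.log ((t⁻¹ - √(t⁻¹ ^ 2 - k ^ 2)) / k)

theorem Lbr_I_mul {u : ℝ} (hu : 0 < u) :
    Lbr (Complex.I * u) = Real.log u + Complex.I * ((Real.pi : ℂ) / 2) := by
  have h : -Complex.I * (Complex.I * (u : ℂ)) = u := by
    rw [← mul_assoc, neg_mul, Complex.I_mul_I]; simp
  rw [Lbr, h, Complex.ofReal_log hu.le]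

theorem Lbr_neg_I_mul {u : ℝ} (hu : 0 < u) :
    Lbr (-(Complex.I * u)) = Real.log u + Complex.I * (3 * (Real.pi : ℂ) / 2) := by
  have h : -Complex.I * -(Complex.I * (u : ℂ)) = (u : ℂ) * (-1 : ℂ) := by
    linear_combination (u : ℂ) * Complex.I_mul_I
  rw [Lbr, h, Complex.log_ofReal_mul hu (by norm_num), Complex.log_neg_one]
  ring

theorem Lbr_re (z : ℂ) : (Lbr z).re = Real.log ‖z‖ := by
  simp [Lbr, Complex.log_re]

theorem L3_re (z : ℂ) : (L3 z).re = Real.log ‖z‖ := by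
  simp [L3, Complex.log_re]

theorem exp_half_log_add {x y : ℝ} (hx : 0 < x) (hy : 0 < y) :
    Complex.exp (1 / 2 * (Real.log x + Real.log y : ℂ)) = √(x * y) := by
  have h : (1 / 2 * (Real.log x + Real.log y) : ℂ) = ((Real.log (√(x * y)) : ℝ) : ℂ) := by
    rw [Real.log_sqrt (by positivity), Real.log_mul hx.ne' hy.ne']
    push_cast; ring
  rw [h, ← Complex.ofReal_exp, Real.exp_log (by positivity)]

theorem sqBr_I_mul {a t : ℝ} (ht : √(2 * cOf a) < t) :
    sqBr a (Complex.I * t) = Complex.I * √(t ^ 2 - √(2 * cOf a) ^ 2) := by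
  have hk := Real.sqrt_nonneg (2 * cOf a)
  rw [sqBr]
  generalize √(2 * cOf a) = k at *
  have h1 : Complex.I * (t : ℂ) + Complex.I * (k : ℂ) = Complex.I * ((t + k : ℝ) : ℂ) := by
    push_cast; ring
  have h2 : Complex.I * (t : ℂ) - Complex.I * (k : ℂ) = Complex.I * ((t - k : ℝ) : ℂ) := by
    push_cast; ring
  have hp : 0 < t + k := by linarith
  have hm : 0 < t - k := by linarith
  rw [h1, h2, Lbr_I_mul hp, Lbr_I_mul hm]
  have h3 : ∀ x y : ℂ, 1 / 2 * (x + Complex.I * ((Real.pi : ℂ) / 2)) +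
      1 / 2 * (y + Complex.I * ((Real.pi : ℂ) / 2)) =
      1 / 2 * (x + y) + (Real.pi : ℂ) / 2 * Complex.I := by
    intro x y; ring
  rw [h3, Complex.exp_add, exp_half_log_add hp hm, Complex.exp_pi_div_two_mul_I, mul_comm,
    show (t + k) * (t - k) = t ^ 2 - k ^ 2 by ring]

theorem sqBr_neg_I_mul {a t : ℝ} (ht : √(2 * cOf a) < t) :
    sqBr a (-(Complex.I * t)) = -(Complex.I * √(t ^ 2 - √(2 * cOf a) ^ 2)) := by
  have hk := Real.sqrt_nonneg (2 * cOf a)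
  rw [sqBr]
  generalize √(2 * cOf a) = k at *
  have h1 : -(Complex.I * (t : ℂ)) + Complex.I * (k : ℂ) =
      -(Complex.I * ((t - k : ℝ) : ℂ)) := by
    push_cast; ring
  have h2 : -(Complex.I * (t : ℂ)) - Complex.I * (k : ℂ) =
      -(Complex.I * ((t + k : ℝ) : ℂ)) := by
    push_cast; ring
  have hp : 0 < t + k := by linarith
  have hm : 0 < t - k := by linarith
  rw [h1, h2, Lbr_neg_I_mul hp, Lbr_neg_I_mul hm]
  have h3 : ∀ x y : ℂ, 1 / 2 * (x + Complex.I * (3 * (Real.pi : ℂ) / 2)) +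
      1 / 2 * (y + Complex.I * (3 * (Real.pi : ℂ) / 2)) =
      1 / 2 * (x + y) + ((Real.pi : ℂ) / 2 * Complex.I + (Real.pi : ℂ) * Complex.I) := by
    intro x y; ring
  rw [h3, Complex.exp_add, exp_half_log_add hm hp, Complex.exp_add,
    Complex.exp_pi_div_two_mul_I, Complex.exp_pi_mul_I,
    show (t - k) * (t + k) = t ^ 2 - k ^ 2 by ring]
  ring

theorem I_mul_inv (t : ℝ) : (Complex.I * (t : ℂ))⁻¹ = -(Complex.I * ((t⁻¹ : ℝ) : ℂ)) := by
  rw [mul_inv, Complex.inv_I]; push_cast; ring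

theorem saddleEq_I_mul_iff {a ξ t : ℝ} (hk : 0 < √(2 * cOf a)) (ht : √(2 * cOf a) < t)
    (ht' : t < 1 / √(2 * cOf a)) :
    saddleEq a ξ ξ (Complex.I * t) ↔ 1 + ξ * saddleFun √(2 * cOf a) t = 0 := by
  have hti : √(2 * cOf a) < t⁻¹ := by
    rw [lt_inv_comm₀ hk (hk.trans ht)]; simpa using ht'
  rw [saddleEq, I_mul_inv, sqBr_I_mul ht, sqBr_neg_I_mul hti, saddleFun]
  generalize √(2 * cOf a) = k at *
  have ht0 : 0 < t := hk.trans ht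
  have h1 : 0 < √(t ^ 2 - k ^ 2) := Real.sqrt_pos.2 (by nlinarith)
  have h2 : 0 < √(t⁻¹ ^ 2 - k ^ 2) := Real.sqrt_pos.2 (by nlinarith)
  have h3 : √(1 - k ^ 2 * t ^ 2) = t * √(t⁻¹ ^ 2 - k ^ 2) := by
    rw [← Real.sqrt_sq ht0.le, ← Real.sqrt_mul (by positivity), Real.sqrt_sq ht0.le]
    congr 1; field_simp
  rw [h3]
  generalize √(t ^ 2 - k ^ 2) = p at *
  generalize √(t⁻¹ ^ 2 - k ^ 2) = q at *
  have e1 : (ξ : ℂ) * (Complex.I * t) / (Complex.I * p) = ((ξ * (t / p) : ℝ) : ℂ) := by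
    rw [mul_left_comm, mul_div_mul_left _ _ Complex.I_ne_zero]; push_cast; ring
  have e2 : Complex.I * (t : ℂ) * -(Complex.I * q) = ((t * q : ℝ) : ℂ) := by
    push_cast; linear_combination -(t : ℂ) * q * Complex.I_mul_I
  rw [e1, e2]
  norm_cast
  rw [mul_add, mul_one_div, add_assoc]

theorem gxi_I_mul_re {a ξ t : ℝ} (hk : 0 < √(2 * cOf a)) (ht : √(2 * cOf a) < t)
    (ht' : t < 1 / √(2 * cOf a)) :
    (gxi a ξ (Complex.I * t)).re = reSaddle √(2 * cOf a) ξ t := by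
  have hti : √(2 * cOf a) < t⁻¹ := by
    rw [lt_inv_comm₀ hk (hk.trans ht)]; simpa using ht'
  rw [gxi, I_mul_inv, Gbr, Gbr, sqBr_I_mul ht, sqBr_neg_I_mul hti, reSaddle]
  generalize √(2 * cOf a) = k at *
  have e1 : (Complex.I * t - Complex.I * √(t ^ 2 - k ^ 2)) / (k : ℂ) =
      Complex.I * (((t - √(t ^ 2 - k ^ 2)) / k : ℝ) : ℂ) := by
    push_cast; ring
  have e2 : (-(Complex.I * ((t⁻¹ : ℝ) : ℂ)) - -(Complex.I * √(t⁻¹ ^ 2 - k ^ 2))) / (k : ℂ) =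
      -Complex.I * (((t⁻¹ - √(t⁻¹ ^ 2 - k ^ 2)) / k : ℝ) : ℂ) := by
    push_cast; ring
  rw [e1, e2, Complex.add_re, Complex.sub_re, Complex.re_ofReal_mul, Complex.re_ofReal_mul,
    Lbr_re, Lbr_re, L3_re]
  simp only [norm_mul, norm_neg, Complex.norm_I, one_mul, Complex.norm_real, Real.norm_eq_abs,
    Real.log_abs]

theorem reSaddle_inv (k ξ t : ℝ) : reSaddle k ξ t⁻¹ = -reSaddle k ξ t := by
  simp only [reSaddle, Real.log_inv, inv_inv]; ring

theorem reSaddle_one (k ξ : ℝ) : reSaddle k ξ 1 = 0 := by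
  simp [reSaddle]

theorem saddleFun_inv {k t : ℝ} (ht : 0 < t) : saddleFun k t⁻¹ = saddleFun k t := by
  have h1 : √(t⁻¹ ^ 2 - k ^ 2) = √(1 - k ^ 2 * t ^ 2) / t := by
    rw [← Real.sqrt_sq ht.le, ← Real.sqrt_div' _ (by positivity), Real.sqrt_sq ht.le]
    congr 1; field_simp
  have h2 : √(1 - k ^ 2 * t⁻¹ ^ 2) = √(t ^ 2 - k ^ 2) / t := by
    rw [← Real.sqrt_sq ht.le, ← Real.sqrt_div' _ (by positivity), Real.sqrt_sq ht.le]
    congr 1; field_simp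
  rw [saddleFun, saddleFun, h1, h2, add_comm, one_div_div, div_div_eq_mul_div,
    inv_mul_cancel₀ ht.ne']

theorem saddleFun_one (k : ℝ) : saddleFun k 1 = 2 / √(1 - k ^ 2) := by
  simp only [saddleFun, one_pow, mul_one]; ring

theorem hasDerivAt_saddleFun {k t : ℝ} (h1 : 0 < t ^ 2 - k ^ 2) (h2 : 0 < 1 - k ^ 2 * t ^ 2) :
    HasDerivAt (saddleFun k)
      (k ^ 2 * t / √(1 - k ^ 2 * t ^ 2) ^ 3 - k ^ 2 / √(t ^ 2 - k ^ 2) ^ 3) t := by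
  have p1 := Real.sqrt_pos.2 h1
  have p2 := Real.sqrt_pos.2 h2
  have d1 : HasDerivAt (fun t : ℝ => t ^ 2 - k ^ 2) (2 * t) t := by
    simpa using (hasDerivAt_pow 2 t).sub_const (k ^ 2)
  have d2 : HasDerivAt (fun t : ℝ => 1 - k ^ 2 * t ^ 2) (-(k ^ 2 * (2 * t))) t := by
    simpa using ((hasDerivAt_pow 2 t).const_mul (k ^ 2)).const_sub 1
  have d := ((hasDerivAt_id t).div (d1.sqrt h1.ne') p1.ne').add
    ((hasDerivAt_const t (1 : ℝ)).div (d2.sqrt h2.ne') p2.ne')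
  refine d.congr_deriv ?_
  have s1 := Real.sq_sqrt h1.le
  simp only [id]
  generalize √(t ^ 2 - k ^ 2) = p at *
  generalize √(1 - k ^ 2 * t ^ 2) = q at *
  have e1 : (1 * p - t * (2 * t / (2 * p))) / p ^ 2 = -(k ^ 2 / p ^ 3) := by
    field_simp; linarith
  rw [e1]
  field_simp
  ring

theorem sq_sub_pos {k t : ℝ} (hk : 0 < k) (ht : k < t) : 0 < t ^ 2 - k ^ 2 := by
  nlinarith

theorem one_sub_mul_sq_pos {k t : ℝ} (hk : 0 < k) (hk1 : k < 1) (h0 : 0 < t) (ht : t ≤ 1) :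
    0 < 1 - k ^ 2 * t ^ 2 := by
  have : k * t < 1 := by nlinarith
  have : 0 < k * t := by positivity
  nlinarith

theorem continuousOn_saddleFun {k : ℝ} (hk : 0 < k) (hk1 : k < 1) :
    ContinuousOn (saddleFun k) (Set.Ioc k 1) := fun _ ht =>
  (hasDerivAt_saddleFun (sq_sub_pos hk ht.1)
    (one_sub_mul_sq_pos hk hk1 (hk.trans ht.1) ht.2)).continuousAt.continuousWithinAt

theorem strictAntiOn_saddleFun {k : ℝ} (hk : 0 < k) (hk1 : k < 1) :
    StrictAntiOn (saddleFun k) (Set.Ioc k 1) := by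
  refine strictAntiOn_of_deriv_neg (convex_Ioc k 1) (continuousOn_saddleFun hk hk1) ?_
  intro t ht
  rw [interior_Ioc] at ht
  obtain ⟨ht1, ht2⟩ := ht
  have ht0 : 0 < t := hk.trans ht1
  have h1 := sq_sub_pos hk ht1
  have h2 := one_sub_mul_sq_pos hk hk1 ht0 ht2.le
  rw [(hasDerivAt_saddleFun h1 h2).deriv, sub_neg]
  have p1 := Real.sqrt_pos.2 h1
  have hlt : √(t ^ 2 - k ^ 2) < √(1 - k ^ 2 * t ^ 2) := Real.sqrt_lt_sqrt h1.le <| by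
    nlinarith [mul_pos (show 0 < 1 - t ^ 2 by nlinarith) (show 0 < 1 + k ^ 2 by positivity)]
  calc k ^ 2 * t / √(1 - k ^ 2 * t ^ 2) ^ 3 < k ^ 2 * 1 / √(1 - k ^ 2 * t ^ 2) ^ 3 := by
        have := Real.sqrt_pos.2 h2
        gcongr
    _ ≤ k ^ 2 / √(t ^ 2 - k ^ 2) ^ 3 := by
        rw [mul_one]; gcongr

theorem hasDerivAt_log_sub_sqrt {k t : ℝ} (hk : 0 < k) (ht : k < t) :
    HasDerivAt (fun t : ℝ => Real.log ((t - √(t ^ 2 - k ^ 2)) / k))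
      (-(1 / √(t ^ 2 - k ^ 2))) t := by
  have h1 := sq_sub_pos hk ht
  have p1 := Real.sqrt_pos.2 h1
  have d1 : HasDerivAt (fun t : ℝ => t ^ 2 - k ^ 2) (2 * t) t := by
    simpa using (hasDerivAt_pow 2 t).sub_const (k ^ 2)
  have hpos : 0 < t - √(t ^ 2 - k ^ 2) := by
    rw [sub_pos, Real.sqrt_lt' (hk.trans ht)]
    nlinarith
  refine ((((hasDerivAt_id t).sub (d1.sqrt h1.ne')).div_const k).log
    (div_pos hpos hk).ne').congr_deriv ?_
  simp only [Pi.sub_apply, id]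
  generalize √(t ^ 2 - k ^ 2) = p at *
  field_simp
  ring

theorem hasDerivAt_reSaddle {k ξ t : ℝ} (hk : 0 < k) (ht : k < t) (ht' : k < t⁻¹) :
    HasDerivAt (reSaddle k ξ) ((1 + ξ * saddleFun k t) / t) t := by
  have ht0 : 0 < t := hk.trans ht
  have d := ((Real.hasDerivAt_log ht0.ne').sub
    ((hasDerivAt_log_sub_sqrt hk ht).const_mul ξ)).add
    (((hasDerivAt_log_sub_sqrt hk ht').comp t (hasDerivAt_inv ht0.ne')).const_mul ξ)
  refine d.congr_deriv ?_
  have p1 := Real.sqrt_pos.2 (sq_sub_pos hk ht)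
  have p2 := Real.sqrt_pos.2 (sq_sub_pos hk ht')
  have h3 : √(1 - k ^ 2 * t ^ 2) = t * √(t⁻¹ ^ 2 - k ^ 2) := by
    rw [← Real.sqrt_sq ht0.le, ← Real.sqrt_mul (by positivity), Real.sqrt_sq ht0.le]
    congr 1; field_simp
  rw [saddleFun, h3]
  generalize √(t ^ 2 - k ^ 2) = p at *
  generalize √(t⁻¹ ^ 2 - k ^ 2) = q at *
  field_simp
  ring

theorem exists_saddleFun_eq {k M : ℝ} (hk : 0 < k) (hk1 : k < 1) (hM : 2 / √(1 - k ^ 2) < M) :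
    ∃ t, k < t ∧ t < 1 ∧ saddleFun k t = M := by
  have hk2 : 0 < 1 - k ^ 2 := by nlinarith
  have hs := Real.sqrt_pos.2 hk2
  have hM0 : 0 < M := lt_trans (by positivity) hM
  have hM2 : 4 < M ^ 2 * (1 - k ^ 2) := by
    rw [div_lt_iff₀ hs] at hM
    calc (4 : ℝ) = 2 ^ 2 := by norm_num
      _ < (M * √(1 - k ^ 2)) ^ 2 := by gcongr
      _ = M ^ 2 * (1 - k ^ 2) := by rw [mul_pow, Real.sq_sqrt hk2.le]
  set t₀ := k * √(1 + 1 / M ^ 2) with ht₀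
  have hr : 1 < √(1 + 1 / M ^ 2) := by
    rw [Real.lt_sqrt zero_le_one, one_pow, lt_add_iff_pos_right]; positivity
  have ht₀sq : t₀ ^ 2 = k ^ 2 * (1 + 1 / M ^ 2) := by
    rw [ht₀, mul_pow, Real.sq_sqrt (by positivity)]
  have hkt : k < t₀ := by nlinarith
  have ht1 : t₀ < 1 := by
    have hinv : 1 / M ^ 2 < (1 - k ^ 2) / 4 := by
      rw [div_lt_div_iff₀ (by positivity) (by norm_num)]; linarith
    have : t₀ ^ 2 < 1 := by
      rw [ht₀sq]
      have : k ^ 2 * (1 / M ^ 2) < k ^ 2 * ((1 - k ^ 2) / 4) := by gcongr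
      nlinarith
    nlinarith
  have hsq : √(t₀ ^ 2 - k ^ 2) = k / M := by
    rw [ht₀sq, show k ^ 2 * (1 + 1 / M ^ 2) - k ^ 2 = (k / M) ^ 2 by field_simp; ring,
      Real.sqrt_sq (by positivity)]
  have hF : M < saddleFun k t₀ := by
    rw [saddleFun, hsq]
    have : M < t₀ / (k / M) := by
      rw [lt_div_iff₀ (by positivity), mul_div_cancel₀ _ hM0.ne']
      exact hkt
    have : 0 ≤ 1 / √(1 - k ^ 2 * t₀ ^ 2) := by positivity
    linarith
  obtain ⟨t, ht, hFt⟩ := intermediate_value_Icc' ht1.le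
    ((continuousOn_saddleFun hk hk1).mono (fun x hx => ⟨hkt.trans_le hx.1, hx.2⟩))
    (show M ∈ Set.Icc (saddleFun k 1) (saddleFun k t₀) from
      ⟨(saddleFun_one k).trans_le hM.le, hF.le⟩)
  refine ⟨t, hkt.trans_le ht.1, lt_of_le_of_ne ht.2 ?_, hFt⟩
  rintro rfl
  rw [saddleFun_one] at hFt
  exact hM.ne hFt

theorem saddleFun_one_lt {k t : ℝ} (hk : 0 < k) (hk1 : k < 1) (ht : k < t) (ht' : k < t⁻¹)
    (hne : t ≠ 1) : saddleFun k 1 < saddleFun k t := by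
  have h := strictAntiOn_saddleFun hk hk1
  rcases lt_or_gt_of_ne hne with h1 | h1
  · exact h ⟨ht, h1.le⟩ ⟨hk1, le_rfl⟩ h1
  · rw [← saddleFun_inv (hk.trans ht)]
    have : t⁻¹ < 1 := inv_lt_one_of_one_lt₀ h1
    exact h ⟨ht', this.le⟩ ⟨hk1, le_rfl⟩ this

theorem saddleFun_eq_iff {k s t : ℝ} (hk : 0 < k) (hk1 : k < 1) (hs : k < s) (hs' : k < s⁻¹)
    (ht : k < t) (ht1 : t < 1) : saddleFun k s = saddleFun k t ↔ s = t ∨ s = t⁻¹ := by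
  have h := (strictAntiOn_saddleFun hk hk1).injOn
  constructor
  · intro he
    rcases le_or_gt s 1 with h1 | h1
    · exact Or.inl (h ⟨hs, h1⟩ ⟨ht, ht1.le⟩ he)
    · rw [← saddleFun_inv (hk.trans hs)] at he
      right
      rw [← h ⟨hs', (inv_lt_one_of_one_lt₀ h1).le⟩ ⟨ht, ht1.le⟩ he, inv_inv]
  · rintro (rfl | rfl)
    · rfl
    · exact saddleFun_inv (hk.trans ht)

theorem reSaddle_neg {k ξ t : ℝ} (hk : 0 < k) (hk1 : k < 1) (hξ : ξ < 0) (ht : k < t)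
    (ht1 : t < 1) (h : 1 + ξ * saddleFun k t = 0) : reSaddle k ξ t < 0 := by
  have hd : ∀ x ∈ Set.Icc t 1,
      HasDerivAt (reSaddle k ξ) ((1 + ξ * saddleFun k x) / x) x := fun x hx =>
    hasDerivAt_reSaddle hk (ht.trans_le hx.1)
      (hk1.trans_le ((one_le_inv₀ (hk.trans (ht.trans_le hx.1))).2 hx.2))
  have hmono : StrictMonoOn (reSaddle k ξ) (Set.Icc t 1) := by
    refine strictMonoOn_of_deriv_pos (convex_Icc t 1)
      (fun x hx => (hd x hx).continuousAt.continuousWithinAt) ?_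
    intro x hx
    rw [interior_Icc] at hx
    rw [(hd x ⟨hx.1.le, hx.2.le⟩).deriv]
    refine div_pos ?_ (hk.trans (ht.trans hx.1))
    have := strictAntiOn_saddleFun hk hk1 ⟨ht, ht1.le⟩ ⟨ht.trans hx.1, hx.2.le⟩ hx.1
    nlinarith
  rw [← reSaddle_one k ξ]
  exact hmono ⟨le_rfl, ht1.le⟩ ⟨ht1.le, le_rfl⟩ ht1

theorem sqrt_two_mul_cOf_pos {a : ℝ} (ha : 0 < a) : 0 < √(2 * cOf a) := by
  rw [Real.sqrt_pos, cOf]; positivity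

theorem two_mul_cOf_lt_one {a : ℝ} (ha : a ≠ 1) : 2 * cOf a < 1 := by
  rw [cOf, ← mul_div_assoc, div_lt_one (by positivity)]
  have := sq_pos_of_ne_zero (sub_ne_zero.2 ha)
  nlinarith

theorem two_div_lt_neg_inv_iff {s ξ : ℝ} (hs : 0 < s) (hξ : ξ < 0) :
    2 / s < -ξ⁻¹ ↔ -(1 / 2) * s < ξ := by
  rw [← inv_neg, ← one_div, div_lt_div_iff₀ hs (neg_pos.2 hξ)]
  constructor <;> intro h <;> linarith

theorem one_add_mul_eq_zero_iff {ξ x : ℝ} (hξ : ξ ≠ 0) : 1 + ξ * x = 0 ↔ x = -ξ⁻¹ := by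
  constructor
  · intro h; field_simp; linarith
  · rintro rfl; field_simp; ring

/-- Let `ξ ∈ (-1, 0)`. The saddle point equation with `ξ₁ = ξ₂ = ξ` has
two distinct solutions in the segment `i·(√(2c), 1/√(2c))` other than `i` if and only if
`-(1/2)√(1-2c) < ξ < 0`. Moreover, when `-(1/2)√(1-2c) < ξ < 0`, there exists
`ω_c ∈ i·(√(2c), 1)` such that the set of solutions of the saddle point equation in
`i·(√(2c), 1/√(2c))` is exactly `{ω_c, -1/ω_c}`, and `Re g_ξ(ω_c) < 0` and
`Re g_ξ(-1/ω_c) > 0`. -/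
theorem statement6 (a : ℝ) (ha0 : 0 < a) (ha1 : a < 1) (ξ : ℝ)
    (hξ1 : -1 < ξ) (hξ0 : ξ < 0) :
    ((∃ ω₁ ω₂ : ℂ, ω₁ ≠ ω₂ ∧ ω₁ ≠ Complex.I ∧ ω₂ ≠ Complex.I ∧
        (∃ t : ℝ, Real.sqrt (2 * cOf a) < t ∧ t < 1 / Real.sqrt (2 * cOf a) ∧
          ω₁ = Complex.I * (t : ℂ)) ∧
        (∃ t : ℝ, Real.sqrt (2 * cOf a) < t ∧ t < 1 / Real.sqrt (2 * cOf a) ∧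
          ω₂ = Complex.I * (t : ℂ)) ∧
        saddleEq a ξ ξ ω₁ ∧ saddleEq a ξ ξ ω₂) ↔
      (-(1 / 2) * Real.sqrt (1 - 2 * cOf a) < ξ ∧ ξ < 0)) ∧
    (-(1 / 2) * Real.sqrt (1 - 2 * cOf a) < ξ →
      ∃ t : ℝ, Real.sqrt (2 * cOf a) < t ∧ t < 1 ∧
        {ω : ℂ | (∃ s : ℝ, Real.sqrt (2 * cOf a) < s ∧ s < 1 / Real.sqrt (2 * cOf a) ∧
            ω = Complex.I * (s : ℂ)) ∧ saddleEq a ξ ξ ω} =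
          {Complex.I * (t : ℂ), -(Complex.I * (t : ℂ))⁻¹} ∧
        (gxi a ξ (Complex.I * (t : ℂ))).re < 0 ∧
        0 < (gxi a ξ (-(Complex.I * (t : ℂ))⁻¹)).re) := by
  have hk := sqrt_two_mul_cOf_pos ha0
  have hc := two_mul_cOf_lt_one ha1.ne
  have hksq : √(2 * cOf a) ^ 2 = 2 * cOf a := Real.sq_sqrt (Real.sqrt_pos.1 hk).le
  have hk1 : √(2 * cOf a) < 1 := by
    rw [Real.sqrt_lt' one_pos]; linarith
  have hM : 2 / √(1 - √(2 * cOf a) ^ 2) < -ξ⁻¹ ↔ -(1 / 2) * √(1 - 2 * cOf a) < ξ := by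
    rw [hksq]
    exact two_div_lt_neg_inv_iff (Real.sqrt_pos.2 (by linarith)) hξ0
  have hsad : ∀ s : ℝ, √(2 * cOf a) < s → s < 1 / √(2 * cOf a) →
      (saddleEq a ξ ξ (Complex.I * s) ↔ saddleFun √(2 * cOf a) s = -ξ⁻¹) := fun s h1 h2 =>
    (saddleEq_I_mul_iff hk h1 h2).trans (one_add_mul_eq_zero_iff hξ0.ne)
  have hg : ∀ s : ℝ, √(2 * cOf a) < s → s < 1 / √(2 * cOf a) →
      (gxi a ξ (Complex.I * s)).re = reSaddle √(2 * cOf a) ξ s := fun s h1 h2 =>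
    gxi_I_mul_re hk h1 h2
  rw [← hM]
  generalize √(2 * cOf a) = k at *
  have hinv : ∀ s : ℝ, k < s → s < 1 / k → k < s⁻¹ := by
    intro s h1 h2
    rw [lt_inv_comm₀ hk (hk.trans h1)]; simpa using h2
  have hinv' : ∀ t : ℝ, k < t → t < 1 → t < 1 / k ∧ k < t⁻¹ ∧ t⁻¹ < 1 / k := by
    intro t h1 h2
    have h3 : 1 < 1 / k := by rwa [lt_div_iff₀ hk, one_mul]
    have h4 : t⁻¹ < 1 / k := by
      rw [one_div]; exact inv_strictAnti₀ hk h1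
    exact ⟨h2.trans h3, hinv t h1 (h2.trans h3), h4⟩
  have hI : ∀ s t : ℝ, Complex.I * (s : ℂ) = Complex.I * (t : ℂ) ↔ s = t := by
    intro s t
    rw [mul_right_inj' Complex.I_ne_zero, Complex.ofReal_inj]
  have hI1 : ∀ s : ℝ, Complex.I * (s : ℂ) = Complex.I ↔ s = 1 := by
    intro s
    rw [← hI s 1, Complex.ofReal_one, mul_one]
  refine ⟨⟨?_, ?_⟩, ?_⟩
  · rintro ⟨_, _, -, hne, -, ⟨t, h1, h2, rfl⟩, -, hs, -⟩
    rw [hsad t h1 h2] at hs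
    rw [Ne, hI1] at hne
    have := saddleFun_one_lt hk hk1 h1 (hinv t h1 h2) hne
    rw [saddleFun_one, hs] at this
    exact ⟨this, hξ0⟩
  · rintro ⟨h, -⟩
    obtain ⟨t, ht, ht1, hF⟩ := exists_saddleFun_eq hk hk1 h
    obtain ⟨h1, h2, h3⟩ := hinv' t ht ht1
    have ht0 := hk.trans ht
    have hlt : 1 < t⁻¹ := (one_lt_inv₀ ht0).2 ht1
    refine ⟨Complex.I * t, Complex.I * (t⁻¹ : ℝ), ?_, ?_, ?_, ⟨t, ht, h1, rfl⟩,
      ⟨t⁻¹, h2, h3, rfl⟩, (hsad t ht h1).2 hF, (hsad _ h2 h3).2 ?_⟩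
    · rw [Ne, hI]; exact (ht1.trans hlt).ne
    · rw [Ne, hI1]; exact ht1.ne
    · rw [Ne, hI1]; exact hlt.ne'
    · rw [saddleFun_inv ht0, hF]
  · intro h
    obtain ⟨t, ht, ht1, hF⟩ := exists_saddleFun_eq hk hk1 h
    obtain ⟨h1, h2, h3⟩ := hinv' t ht ht1
    have hneg := reSaddle_neg hk hk1 hξ0 ht ht1 ((one_add_mul_eq_zero_iff hξ0.ne).2 hF)
    refine ⟨t, ht, ht1, ?_, ?_, ?_⟩
    · rw [I_mul_inv, neg_neg]
      ext ω
      simp only [Set.mem_ofPred_eq, Set.mem_insert_iff, Set.mem_singleton_iff]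
      constructor
      · rintro ⟨⟨s, hs1, hs2, rfl⟩, hs⟩
        rw [hsad s hs1 hs2, ← hF, saddleFun_eq_iff hk hk1 hs1 (hinv s hs1 hs2) ht ht1] at hs
        rwa [hI, hI]
      · rintro (rfl | rfl)
        · exact ⟨⟨t, ht, h1, rfl⟩, (hsad t ht h1).2 hF⟩
        · exact ⟨⟨_, h2, h3, rfl⟩,
            (hsad _ h2 h3).2 ((saddleFun_inv (hk.trans ht)).trans hF)⟩
    · rwa [hg t ht h1]
    · rw [I_mul_inv, neg_neg, hg _ h2 h3, reSaddle_inv]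
      linarith
end

section
/- For all integers k, ℓ with k ≥ 0, the double contour integral E_{k,ℓ} equals the single contour integral: E_{k,ℓ} = i^{-k-ℓ} (2(1+a^2))^{-1} (2πi)^{-1} ∮_{|ω|=1} G(ω)^{ℓ} G(1/ω)^{k} / (ω·√(ω^2+2c)·√(ω^{-2}+2c)) dω, the unit circle positively oriented. -/
/-- `č(u,v) = 2(1+a²) + a(u + 1/u)(v + 1/v)`. -/
noncomputable def ccheck (a : ℝ) (u v : ℂ) : ℂ :=
  2 * (1 + (a : ℂ) ^ 2) + (a : ℂ) * (u + u⁻¹) * (v + v⁻¹)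

/-- The double contour integral
`E_{k,ℓ} = (2πi)⁻² ∮_{|u₁|=1} ∮_{|u₂|=1} u₁^ℓ u₂^k / (č(u₁,u₂)·u₁·u₂) du₂ du₁`. -/
noncomputable def EE (a : ℝ) (k l : ℤ) : ℂ :=
  ((2 * (Real.pi : ℂ) * Complex.I) ^ 2)⁻¹ *
    ∮ u₁ in C(0, 1), ∮ u₂ in C(0, 1), u₁ ^ l * u₂ ^ k / (ccheck a u₁ u₂ * u₁ * u₂)

open Complex in
/-- The principal square root of `1 + s² / ω²`. -/
noncomputable def sqrtRatio (s : ℝ) (ω : ℂ) : ℂ :=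
  exp (1 / 2 * log (1 + (s : ℂ) ^ 2 * (ω ^ 2)⁻¹))

open Complex in
/-- The small solution `u` of `I * s * (u + u⁻¹) = 2 * ω`. -/
noncomputable def smallRoot (s : ℝ) (ω : ℂ) : ℂ :=
  -I * ω * (1 - sqrtRatio s ω) / s

open Complex in
/-- The map `u ↦ I * s * (u + u⁻¹) / 2`. -/
noncomputable def joukowsky (s : ℝ) (u : ℂ) : ℂ := I * s / 2 * (u + u⁻¹)

section Aux

open Complex Metric

variable {s : ℝ} {ω : ℂ}

lemma ne_zero_of_mem_unit_circle (hω : ω ∈ sphere (0 : ℂ) 1) : ω ≠ 0 := by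
  rintro rfl
  simp at hω

lemma norm_ratio_lt_one (hs : 0 < s) (hs1 : s < 1) (hω : ω ∈ sphere (0 : ℂ) 1) :
    ‖(s : ℂ) ^ 2 * (ω ^ 2)⁻¹‖ < 1 := by
  have : ‖ω‖ = 1 := by simpa using hω
  simp only [norm_mul, norm_inv, norm_pow, this, norm_real, Real.norm_eq_abs, abs_of_pos hs]
  nlinarith

lemma one_add_ratio_mem_slitPlane (hs : 0 < s) (hs1 : s < 1) (hω : ω ∈ sphere (0 : ℂ) 1) :
    1 + (s : ℂ) ^ 2 * (ω ^ 2)⁻¹ ∈ slitPlane :=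
  mem_slitPlane_of_norm_lt_one (norm_ratio_lt_one hs hs1 hω)

lemma sqrtRatio_sq (hs : 0 < s) (hs1 : s < 1) (hω : ω ∈ sphere (0 : ℂ) 1) :
    sqrtRatio s ω ^ 2 = 1 + (s : ℂ) ^ 2 * (ω ^ 2)⁻¹ := by
  rw [sqrtRatio, ← exp_nat_mul]
  rw [show ((2 : ℕ) : ℂ) * (1 / 2 * log (1 + (s : ℂ) ^ 2 * (ω ^ 2)⁻¹)) =
    log (1 + (s : ℂ) ^ 2 * (ω ^ 2)⁻¹) by push_cast; ring]
  exact exp_log (slitPlane_ne_zero (one_add_ratio_mem_slitPlane hs hs1 hω))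

lemma sqrtRatio_re_pos (hs : 0 < s) (hs1 : s < 1) (hω : ω ∈ sphere (0 : ℂ) 1) :
    0 < (sqrtRatio s ω).re := by
  have h := one_add_ratio_mem_slitPlane hs hs1 hω
  rw [sqrtRatio, exp_re]
  refine mul_pos (Real.exp_pos _) (Real.cos_pos_of_mem_Ioo ?_)
  have h1 := neg_pi_lt_arg (1 + (s : ℂ) ^ 2 * (ω ^ 2)⁻¹)
  have h2 := lt_of_le_of_ne (arg_le_pi _) (mem_slitPlane_iff_arg.1 h).1
  have : (1 / 2 * log (1 + (s : ℂ) ^ 2 * (ω ^ 2)⁻¹)).im =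
      (1 + (s : ℂ) ^ 2 * (ω ^ 2)⁻¹).arg / 2 := by
    rw [mul_im, log_im]
    norm_num
    ring
  rw [this]
  constructor <;> linarith

lemma sqrtRatio_ne_zero : sqrtRatio s ω ≠ 0 := exp_ne_zero _

lemma hasDerivAt_sqrtRatio (hs : 0 < s) (hs1 : s < 1) (hω : ω ∈ sphere (0 : ℂ) 1) :
    HasDerivAt (sqrtRatio s) (-((s : ℂ) ^ 2 * (ω ^ 3)⁻¹) / sqrtRatio s ω) ω := by
  have h0 := ne_zero_of_mem_unit_circle hω
  have h := one_add_ratio_mem_slitPlane hs hs1 hω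
  have h1 : HasDerivAt (fun z : ℂ => 1 + (s : ℂ) ^ 2 * (z ^ 2)⁻¹)
      ((s : ℂ) ^ 2 * (-(2 * ω) / (ω ^ 2) ^ 2)) ω := by
    have := (((hasDerivAt_pow 2 ω).inv (pow_ne_zero 2 h0)).const_mul ((s : ℂ) ^ 2)).const_add 1
    simpa using this
  have h2 := ((h1.clog h).const_mul (1 / 2 : ℂ)).cexp
  have hS : sqrtRatio s ω ≠ 0 := sqrtRatio_ne_zero
  refine h2.congr_deriv ?_
  change sqrtRatio s ω * _ = _
  rw [← sqrtRatio_sq hs hs1 hω]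
  field_simp

lemma sq_ratio_ne_zero (hs : 0 < s) (hω : ω ∈ sphere (0 : ℂ) 1) :
    (s : ℂ) ^ 2 * (ω ^ 2)⁻¹ ≠ 0 :=
  mul_ne_zero (pow_ne_zero 2 (ofReal_ne_zero.2 hs.ne'))
    (inv_ne_zero (pow_ne_zero 2 (ne_zero_of_mem_unit_circle hω)))

lemma sqrtRatio_ne_one (hs : 0 < s) (hs1 : s < 1) (hω : ω ∈ sphere (0 : ℂ) 1) :
    sqrtRatio s ω ≠ 1 := by
  intro h
  have := sqrtRatio_sq hs hs1 hω
  rw [h] at this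
  exact sq_ratio_ne_zero hs hω (by linear_combination -this)

lemma smallRoot_ne_zero (hs : 0 < s) (hs1 : s < 1) (hω : ω ∈ sphere (0 : ℂ) 1) :
    smallRoot s ω ≠ 0 := by
  have h0 := ne_zero_of_mem_unit_circle hω
  have h1 := sub_ne_zero.2 (sqrtRatio_ne_one hs hs1 hω).symm
  have h2 : (s : ℂ) ≠ 0 := ofReal_ne_zero.2 hs.ne'
  simp [smallRoot, h0, h1, h2]

lemma smallRoot_inv (hs : 0 < s) (hs1 : s < 1) (hω : ω ∈ sphere (0 : ℂ) 1) :
    (smallRoot s ω)⁻¹ = -I * ω * (1 + sqrtRatio s ω) / s := by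
  have h0 := ne_zero_of_mem_unit_circle hω
  have h2 : (s : ℂ) ≠ 0 := ofReal_ne_zero.2 hs.ne'
  refine inv_eq_of_mul_eq_one_right ?_
  have := sqrtRatio_sq hs hs1 hω
  have e : smallRoot s ω * (-I * ω * (1 + sqrtRatio s ω) / s) =
      (I ^ 2 * ω ^ 2 * (1 - sqrtRatio s ω ^ 2)) / s ^ 2 := by
    rw [smallRoot]
    field_simp
    ring
  rw [e, this, I_sq]
  field_simp
  ring

lemma joukowsky_smallRoot (hs : 0 < s) (hs1 : s < 1) (hω : ω ∈ sphere (0 : ℂ) 1) :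
    joukowsky s (smallRoot s ω) = ω := by
  have h2 : (s : ℂ) ≠ 0 := ofReal_ne_zero.2 hs.ne'
  rw [joukowsky, smallRoot_inv hs hs1 hω, smallRoot]
  field_simp
  linear_combination (-2 * ω) * I_sq

lemma norm_smallRoot_lt_one (hs : 0 < s) (hs1 : s < 1) (hω : ω ∈ sphere (0 : ℂ) 1) :
    ‖smallRoot s ω‖ < 1 := by
  have hn : ‖ω‖ = 1 := by simpa using hω
  have h1 : 1 < ‖(smallRoot s ω)⁻¹‖ := by
    rw [smallRoot_inv hs hs1 hω]
    simp only [norm_div, norm_mul, norm_neg, norm_I, hn, norm_real, Real.norm_eq_abs,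
      abs_of_pos hs, one_mul]
    have h2 := re_le_norm (1 + sqrtRatio s ω)
    have h3 := sqrtRatio_re_pos hs hs1 hω
    rw [add_re, one_re] at h2
    rw [lt_div_iff₀ hs]
    linarith
  rw [norm_inv] at h1
  by_contra! h
  exact absurd (inv_le_one_of_one_le₀ h) (not_le.2 h1)

lemma hasDerivAt_smallRoot (hs : 0 < s) (hs1 : s < 1) (hω : ω ∈ sphere (0 : ℂ) 1) :
    HasDerivAt (smallRoot s) (-(smallRoot s ω / (ω * sqrtRatio s ω))) ω := by
  have h0 := ne_zero_of_mem_unit_circle hω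
  have h2 : (s : ℂ) ≠ 0 := ofReal_ne_zero.2 hs.ne'
  have hS : sqrtRatio s ω ≠ 0 := sqrtRatio_ne_zero
  have h := (((hasDerivAt_id ω).const_mul (-I)).mul
    ((hasDerivAt_sqrtRatio hs hs1 hω).const_sub 1)).div_const (s : ℂ)
  refine h.congr_deriv ?_
  have e := sqrtRatio_sq hs hs1 hω
  have e' : (s : ℂ) ^ 2 = (sqrtRatio s ω ^ 2 - 1) * ω ^ 2 := by
    rw [e]
    field_simp
    ring
  simp only [id]
  rw [smallRoot, e']
  field_simp
  ring

lemma continuousOn_sqrtRatio (hs : 0 < s) (hs1 : s < 1) :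
    ContinuousOn (sqrtRatio s) (sphere (0 : ℂ) 1) :=
  fun _ hω => (hasDerivAt_sqrtRatio hs hs1 hω).continuousAt.continuousWithinAt

lemma continuousOn_smallRoot (hs : 0 < s) (hs1 : s < 1) :
    ContinuousOn (smallRoot s) (sphere (0 : ℂ) 1) :=
  fun _ hω => (hasDerivAt_smallRoot hs hs1 hω).continuousAt.continuousWithinAt

lemma continuousOn_smallRoot_zpow (hs : 0 < s) (hs1 : s < 1) (l : ℤ) :
    ContinuousOn (fun ω => smallRoot s ω ^ l / (ω * sqrtRatio s ω)) (sphere (0 : ℂ) 1) := by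
  refine ((continuousOn_smallRoot hs hs1).zpow₀ l fun z hz =>
    Or.inl (smallRoot_ne_zero hs hs1 hz)).div
      (continuousOn_id.mul (continuousOn_sqrtRatio hs hs1)) fun z hz =>
      mul_ne_zero (ne_zero_of_mem_unit_circle hz) sqrtRatio_ne_zero

lemma circleIntegral_smallRoot_zpow_of_ne (hs : 0 < s) (hs1 : s < 1) {l : ℤ} (hl : l ≠ 0) :
    ∮ ω in C(0, 1), smallRoot s ω ^ l / (ω * sqrtRatio s ω) = 0 := by
  have hl' : (l : ℂ) ≠ 0 := Int.cast_ne_zero.2 hl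
  refine circleIntegral.integral_eq_zero_of_hasDerivWithinAt
    (f := fun ω => -(l : ℂ)⁻¹ * smallRoot s ω ^ l) zero_le_one fun ω hω => ?_
  have hU := smallRoot_ne_zero hs hs1 hω
  have h := ((hasDerivAt_zpow l (smallRoot s ω) (Or.inl hU)).comp ω
    (hasDerivAt_smallRoot hs hs1 hω)).const_mul (-(l : ℂ)⁻¹)
  refine (h.congr_deriv ?_).hasDerivWithinAt
  rw [zpow_sub_one₀ hU]
  have h0 := ne_zero_of_mem_unit_circle hω
  have hS : sqrtRatio s ω ≠ 0 := sqrtRatio_ne_zero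
  field_simp

lemma circleIntegral_inv_mul_sqrtRatio (hs : 0 < s) (hs1 : s < 1) :
    ∮ ω in C(0, 1), 1 / (ω * sqrtRatio s ω) = 2 * (Real.pi : ℂ) * I := by
  have hlog : ∮ ω in C(0, 1), (1 / (ω * sqrtRatio s ω) - (ω - 0)⁻¹) = 0 := by
    refine circleIntegral.integral_eq_zero_of_hasDerivWithinAt
      (f := fun ω => log (1 + sqrtRatio s ω)) zero_le_one fun ω hω => ?_
    have hre : 0 < (1 + sqrtRatio s ω).re := by
      rw [add_re, one_re]
      linarith [sqrtRatio_re_pos hs hs1 hω]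
    have hm : 1 + sqrtRatio s ω ∈ slitPlane := Or.inl hre
    have h := ((hasDerivAt_sqrtRatio hs hs1 hω).const_add 1).clog hm
    refine (h.congr_deriv ?_).hasDerivWithinAt
    have h0 := ne_zero_of_mem_unit_circle hω
    have hS : sqrtRatio s ω ≠ 0 := sqrtRatio_ne_zero
    have h1 := slitPlane_ne_zero hm
    have e' : (s : ℂ) ^ 2 = (sqrtRatio s ω ^ 2 - 1) * ω ^ 2 := by
      rw [sqrtRatio_sq hs hs1 hω]
      field_simp
      ring
    rw [e', sub_zero]
    field_simp
    ring
  rw [circleIntegral.integral_sub, circleIntegral.integral_sub_center_inv 0 one_ne_zero] at hlog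
  · exact sub_eq_zero.1 hlog
  · simpa using (continuousOn_smallRoot_zpow hs hs1 0).circleIntegrable zero_le_one
  · refine ContinuousOn.circleIntegrable zero_le_one ?_
    exact (continuousOn_id.sub continuousOn_const).inv₀ fun z hz => by
      simpa using ne_zero_of_mem_unit_circle hz

lemma continuousOn_joukowsky : ContinuousOn (joukowsky s) (sphere (0 : ℂ) 1) :=
  continuousOn_const.mul (continuousOn_id.add
    (continuousOn_id.inv₀ fun _ hz => ne_zero_of_mem_unit_circle hz))

lemma circleIntegral_zpow_div (l : ℤ) :
    ∮ u in C(0, 1), u ^ l / u = if l = 0 then 2 * (Real.pi : ℂ) * I else 0 := by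
  have : ∮ u in C(0, 1), u ^ l / u = ∮ u in C(0, 1), (u - 0) ^ (l - 1) :=
    circleIntegral.integral_congr zero_le_one fun u hu => by
      simp [zpow_sub_one₀ (ne_zero_of_mem_unit_circle hu), div_eq_mul_inv]
  rw [this]
  split_ifs with h
  · subst h
    simpa using circleIntegral.integral_sub_center_inv 0 one_ne_zero
  · exact circleIntegral.integral_sub_zpow_of_ne (by omega) 0 0 1

lemma circleIntegral_smallRoot_zpow_mul_pow (hs : 0 < s) (hs1 : s < 1) (n : ℕ) (l : ℤ) :
    ∮ ω in C(0, 1), smallRoot s ω ^ l / (ω * sqrtRatio s ω) * ω ^ n =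
      ∮ u in C(0, 1), u ^ l / u * joukowsky s u ^ n := by
  induction n generalizing l with
  | zero =>
    simp only [pow_zero, mul_one, circleIntegral_zpow_div]
    split_ifs with h
    · subst h
      simpa using circleIntegral_inv_mul_sqrtRatio hs hs1
    · exact circleIntegral_smallRoot_zpow_of_ne hs hs1 h
  | succ n ih =>
    have hc (l : ℤ) : CircleIntegrable
        (fun ω => smallRoot s ω ^ l / (ω * sqrtRatio s ω) * ω ^ n) 0 1 :=
      ((continuousOn_smallRoot_zpow hs hs1 l).mul
        (continuousOn_id.pow n)).circleIntegrable zero_le_one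
    have hc' (l : ℤ) : CircleIntegrable (fun u => u ^ l / u * joukowsky s u ^ n) 0 1 :=
      (((continuousOn_id.zpow₀ l fun z hz => Or.inl (ne_zero_of_mem_unit_circle hz)).div
        continuousOn_id fun z hz => ne_zero_of_mem_unit_circle hz).mul
          (continuousOn_joukowsky.pow n)).circleIntegrable zero_le_one
    have e1 : ∮ ω in C(0, 1), smallRoot s ω ^ l / (ω * sqrtRatio s ω) * ω ^ (n + 1) =
        ∮ ω in C(0, 1), I * s / 2 * (smallRoot s ω ^ (l + 1) / (ω * sqrtRatio s ω) * ω ^ n +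
          smallRoot s ω ^ (l - 1) / (ω * sqrtRatio s ω) * ω ^ n) :=
      circleIntegral.integral_congr zero_le_one fun ω hω => by
        have hU := smallRoot_ne_zero hs hs1 hω
        have hj := joukowsky_smallRoot hs hs1 hω
        rw [joukowsky] at hj
        simp only [zpow_sub_one₀ hU, zpow_add_one₀ hU]
        rw [pow_succ]
        linear_combination
          (-(smallRoot s ω ^ l / (ω * sqrtRatio s ω) * ω ^ n)) * hj
    have e2 : ∮ u in C(0, 1), u ^ l / u * joukowsky s u ^ (n + 1) =
        ∮ u in C(0, 1), I * s / 2 * (u ^ (l + 1) / u * joukowsky s u ^ n +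
          u ^ (l - 1) / u * joukowsky s u ^ n) :=
      circleIntegral.integral_congr zero_le_one fun u hu => by
        have hU := ne_zero_of_mem_unit_circle hu
        simp only [zpow_sub_one₀ hU, zpow_add_one₀ hU]
        rw [pow_succ]
        nth_rewrite 2 [joukowsky]
        ring
    rw [e1, e2, circleIntegral.integral_const_mul, circleIntegral.integral_const_mul,
      circleIntegral.integral_add (hc _) (hc _), circleIntegral.integral_add (hc' _) (hc' _),
      ih, ih]

lemma abs_arg_sub_arg_lt_pi (hs : 0 < s) (hs1 : s < 1) {z : ℂ} (hz : ‖z‖ = 1) :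
    |(z + s).arg - (z - s).arg| < Real.pi := by
  have hp := Real.pi_pos
  have i1 : (z + s).im = z.im := by simp
  have i2 : (z - s).im = z.im := by simp
  rcases lt_trichotomy z.im 0 with h | h | h
  · have h1 := arg_neg_iff.2 (i1.trans_lt h)
    have h2 := arg_neg_iff.2 (i2.trans_lt h)
    have h3 := neg_pi_lt_arg (z + s)
    have h4 := neg_pi_lt_arg (z - s)
    rw [abs_lt]
    constructor <;> linarith
  · have hre : z.re * z.re = 1 := by
      have := normSq_eq_norm_sq z
      rw [normSq_apply, h, hz] at this
      linarith
    have hzr : z = (z.re : ℂ) := by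
      apply Complex.ext <;> simp [h]
    rcases mul_self_eq_one_iff.1 hre with h1 | h1
    · have e1 : (z + s).arg = 0 := by
        rw [hzr, h1, ← ofReal_add]
        exact arg_ofReal_of_nonneg (by linarith)
      have e2 : (z - s).arg = 0 := by
        rw [hzr, h1, ← ofReal_sub]
        exact arg_ofReal_of_nonneg (by linarith)
      simpa [e1, e2] using hp
    · have e1 : (z + s).arg = Real.pi := by
        rw [hzr, h1, ← ofReal_add]
        exact arg_ofReal_of_neg (by linarith)
      have e2 : (z - s).arg = Real.pi := by
        rw [hzr, h1, ← ofReal_sub]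
        exact arg_ofReal_of_neg (by linarith)
      simpa [e1, e2] using hp
  · have h1 := arg_nonneg_iff.2 (h.le.trans_eq i1.symm)
    have h2 := arg_nonneg_iff.2 (h.le.trans_eq i2.symm)
    have h3 := arg_lt_pi_iff.2 (Or.inr (i1.trans_ne h.ne'))
    have h4 := arg_lt_pi_iff.2 (Or.inr (i2.trans_ne h.ne'))
    rw [abs_lt]
    constructor <;> linarith

lemma exp_half_log_sq {z : ℂ} (hz : z ≠ 0) : exp (1 / 2 * log z) ^ 2 = z := by
  rw [← exp_nat_mul, show ((2 : ℕ) : ℂ) * (1 / 2 * log z) = log z by push_cast; ring, exp_log hz]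

lemma exp_half_log_inner_pos {z w : ℂ} (h : |z.arg - w.arg| < Real.pi) :
    0 < (exp (1 / 2 * log z)).re * (exp (1 / 2 * log w)).re +
      (exp (1 / 2 * log z)).im * (exp (1 / 2 * log w)).im := by
  have him (z : ℂ) : (1 / 2 * log z).im = z.arg / 2 := by
    rw [mul_im, log_im]
    norm_num
    ring
  have hcos : 0 < Real.cos (z.arg / 2 - w.arg / 2) := by
    rw [abs_lt] at h
    refine Real.cos_pos_of_mem_Ioo ⟨?_, ?_⟩ <;> linarith [h.1, h.2]
  rw [exp_re, exp_re, exp_im, exp_im, him, him]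
  have := mul_pos (mul_pos (Real.exp_pos (1 / 2 * log z).re) (Real.exp_pos (1 / 2 * log w).re)) hcos
  rw [Real.cos_sub] at this
  linarith

lemma exp_half_Lbr_add (hs : 0 < s) (hs1 : s < 1) (hω : ω ∈ sphere (0 : ℂ) 1) :
    exp (1 / 2 * Lbr (ω + I * s) + 1 / 2 * Lbr (ω - I * s)) = ω * sqrtRatio s ω := by
  have hn : ‖ω‖ = 1 := by simpa using hω
  set z : ℂ := -I * ω with hz
  have hzn : ‖z‖ = 1 := by simp [hz, hn]
  have hωz : ω = I * z := by
    rw [hz]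
    linear_combination ω * I_sq
  have ne_of_norm (t : ℂ) (ht : ‖t‖ < 1) : z + t ≠ 0 := by
    intro h
    rw [eq_neg_of_add_eq_zero_left h, norm_neg] at hzn
    exact ht.ne hzn
  have hsn : ‖(s : ℂ)‖ < 1 := by simpa [abs_of_pos hs] using hs1
  have hp0 : z + s ≠ 0 := ne_of_norm _ hsn
  have hq0 : z - s ≠ 0 := by
    rw [sub_eq_add_neg]
    exact ne_of_norm _ (by rwa [norm_neg])
  have hpos := exp_half_log_inner_pos (abs_arg_sub_arg_lt_pi hs hs1 hzn)
  have hp2 := exp_half_log_sq hp0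
  have hq2 := exp_half_log_sq hq0
  have hexp : exp (1 / 2 * Lbr (ω + I * s) + 1 / 2 * Lbr (ω - I * s)) =
      I * (exp (1 / 2 * log (z + s)) * exp (1 / 2 * log (z - s))) := by
    have e1 : -I * (ω + I * s) = z + s := by
      rw [hz]
      linear_combination (-(s : ℂ)) * I_sq
    have e2 : -I * (ω - I * s) = z - s := by
      rw [hz]
      linear_combination (s : ℂ) * I_sq
    rw [Lbr, Lbr, e1, e2, ← exp_add]
    conv_rhs => rw [← exp_pi_div_two_mul_I, ← exp_add]
    congr 1
    ring
  rw [hexp]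
  generalize exp (1 / 2 * log (z + s)) = p at *
  generalize exp (1 / 2 * log (z - s)) = q at *
  have hre : 0 < (p * q * (starRingEnd ℂ) z).re := by
    have hz2 : z = (p ^ 2 + q ^ 2) / 2 := by
      rw [hp2, hq2]
      ring
    have hzre : z.re = (p.re ^ 2 - p.im ^ 2 + q.re ^ 2 - q.im ^ 2) / 2 := by
      rw [hz2]
      simp [pow_two]
      ring
    have hzim : z.im = p.re * p.im + q.re * q.im := by
      rw [hz2]
      simp [pow_two]
      ring
    have e : (p * q * (starRingEnd ℂ) z).re =
        (p.re ^ 2 + p.im ^ 2 + q.re ^ 2 + q.im ^ 2) / 2 * (p.re * q.re + p.im * q.im) := by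
      simp only [mul_re, mul_im, conj_re, conj_im, hzre, hzim]
      ring
    rw [e]
    refine mul_pos ?_ hpos
    by_contra! hle
    nlinarith [sq_nonneg (p.re - q.re), sq_nonneg (p.im - q.im)]
  have hzz : z * (starRingEnd ℂ) z = 1 := by
    rw [mul_conj, normSq_eq_norm_sq, hzn]
    norm_num
  have hS := sqrtRatio_sq hs hs1 hω
  have hSpos := sqrtRatio_re_pos hs hs1 hω
  have hsq : (p * q * (starRingEnd ℂ) z) ^ 2 = sqrtRatio s ω ^ 2 := by
    have hz0 : z ≠ 0 := by
      rintro h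
      simp [h] at hzn
    have hc : (starRingEnd ℂ) z = z⁻¹ := (inv_eq_of_mul_eq_one_right hzz).symm
    rw [hS, mul_pow, mul_pow, hp2, hq2, hc, hωz, mul_pow, I_sq]
    field_simp
    ring
  rcases sq_eq_sq_iff_eq_or_eq_neg.1 hsq with h | h
  · rw [← h, hωz]
    linear_combination (-(I * p * q)) * hzz
  · rw [h, neg_re] at hre
    linarith

lemma hasSum_circleIntegral {F : ℕ → ℂ → ℂ} {f : ℂ → ℂ} {b : ℕ → ℝ} (hb : Summable b)
    (hF : ∀ n, ContinuousOn (F n) (sphere (0 : ℂ) 1))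
    (hFb : ∀ n, ∀ z ∈ sphere (0 : ℂ) 1, ‖F n z‖ ≤ b n)
    (hf : ∀ z ∈ sphere (0 : ℂ) 1, HasSum (fun n => F n z) (f z)) :
    HasSum (fun n => ∮ z in C(0, 1), F n z) (∮ z in C(0, 1), f z) := by
  have hm (t : ℝ) : circleMap (0 : ℂ) 1 t ∈ sphere (0 : ℂ) 1 :=
    circleMap_mem_sphere 0 zero_le_one t
  refine intervalIntegral.hasSum_integral_of_dominated_convergence (fun n _ => b n)
    (fun n => ?_) (fun n => ?_) ?_ ?_ ?_
  · refine Continuous.aestronglyMeasurable ?_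
    simp only [deriv_circleMap]
    exact ((continuous_circleMap 0 1).mul continuous_const).smul
      ((hF n).comp_continuous (continuous_circleMap 0 1) hm)
  · refine Filter.Eventually.of_forall fun t _ => ?_
    simpa using hFb n _ (hm t)
  · exact Filter.Eventually.of_forall fun _ _ => hb
  · exact intervalIntegrable_const
  · exact Filter.Eventually.of_forall fun t _ => (hf _ (hm t)).const_smul _

lemma norm_joukowsky_le (hs : 0 < s) {u : ℂ} (hu : u ∈ sphere (0 : ℂ) 1) :
    ‖joukowsky s u‖ ≤ s := by
  have hn : ‖u‖ = 1 := by simpa using hu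
  have h := norm_add_le u u⁻¹
  rw [norm_inv, hn] at h
  have e : ‖joukowsky s u‖ = s / 2 * ‖u + u⁻¹‖ := by
    simp [joukowsky, abs_of_pos hs]
  rw [e]
  nlinarith

/-- The integral of `v ^ (k - 1) / (1 - ω * joukowsky s v)` over the unit circle. -/
noncomputable def resolventIntegral (s : ℝ) (k : ℕ) (ω : ℂ) : ℂ :=
  ∮ v in C(0, 1), v ^ k / v * (1 - ω * joukowsky s v)⁻¹

lemma continuousOn_pow_div (k : ℕ) (n : ℕ) :
    ContinuousOn (fun v => v ^ k / v * joukowsky s v ^ n) (sphere (0 : ℂ) 1) :=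
  (((continuousOn_id.pow k).div continuousOn_id fun _ hz =>
    ne_zero_of_mem_unit_circle hz)).mul (continuousOn_joukowsky.pow n)

lemma norm_pow_div_mul_le (hs : 0 < s) (k n : ℕ) {v : ℂ} (hv : v ∈ sphere (0 : ℂ) 1) :
    ‖v ^ k / v * joukowsky s v ^ n‖ ≤ s ^ n := by
  have hn : ‖v‖ = 1 := by simpa using hv
  simpa [hn] using pow_le_pow_left₀ (norm_nonneg _) (norm_joukowsky_le hs hv) n

lemma hasSum_resolventIntegral (hs : 0 < s) (hs1 : s < 1) (k : ℕ) (hω : ‖ω‖ ≤ 1) :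
    HasSum (fun n => ω ^ n * ∮ v in C(0, 1), v ^ k / v * joukowsky s v ^ n)
      (resolventIntegral s k ω) := by
  simp only [← circleIntegral.integral_const_mul]
  refine hasSum_circleIntegral (summable_geometric_of_lt_one hs.le hs1)
    (fun n => continuousOn_const.mul (continuousOn_pow_div k n)) (fun n v hv => ?_)
    fun v hv => ?_
  · rw [norm_mul, norm_pow]
    exact (mul_le_of_le_one_left (norm_nonneg _) (pow_le_one₀ (norm_nonneg _) hω)).trans
      (norm_pow_div_mul_le hs k n hv)
  · have h : ‖ω * joukowsky s v‖ < 1 := by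
      rw [norm_mul]
      exact ((mul_le_of_le_one_left (norm_nonneg _) hω).trans (norm_joukowsky_le hs hv)).trans_lt
        hs1
    refine ((hasSum_geometric_of_norm_lt_one h).mul_left (v ^ k / v)).congr_fun ?_
    intro n
    ring

lemma circleIntegral_mul_resolventIntegral (hs : 0 < s) (hs1 : s < 1) (k : ℕ) (l : ℤ) :
    ∮ u in C(0, 1), u ^ l / u * resolventIntegral s k (joukowsky s u) =
      ∮ ω in C(0, 1), smallRoot s ω ^ l / (ω * sqrtRatio s ω) * resolventIntegral s k ω := by
  have key (f g : ℂ → ℂ) (hf : ContinuousOn f (sphere 0 1)) (hg : ContinuousOn g (sphere 0 1))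
      (hg1 : ∀ z ∈ sphere (0 : ℂ) 1, ‖g z‖ ≤ 1) :
      HasSum (fun n => (∮ v in C(0, 1), v ^ k / v * joukowsky s v ^ n) *
        ∮ z in C(0, 1), f z * g z ^ n) (∮ z in C(0, 1), f z * resolventIntegral s k (g z)) := by
    obtain ⟨C, hC⟩ := (isCompact_sphere (0 : ℂ) 1).exists_bound_of_continuousOn hf
    simp only [← circleIntegral.integral_const_mul]
    refine hasSum_circleIntegral (b := fun n => 2 * Real.pi * 1 * s ^ n * C)
      (((summable_geometric_of_lt_one hs.le hs1).mul_left _).mul_right C)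
      (fun n => continuousOn_const.mul (hf.mul (hg.pow n))) (fun n z hz => ?_) fun z hz => ?_
    · rw [norm_mul, norm_mul, norm_pow]
      refine mul_le_mul (circleIntegral.norm_integral_le_of_norm_le_const zero_le_one
        fun v hv => norm_pow_div_mul_le hs k n hv) ?_ (by positivity) (by positivity)
      exact (mul_le_of_le_one_right (norm_nonneg _)
        (pow_le_one₀ (norm_nonneg _) (hg1 z hz))).trans (hC z hz)
    · refine ((hasSum_resolventIntegral hs hs1 k (hg1 z hz)).mul_left (f z)).congr_fun ?_
      intro n
      ring
  have h1 := key (fun u => u ^ l / u) (joukowsky s)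
    ((continuousOn_id.zpow₀ l fun z hz => Or.inl (ne_zero_of_mem_unit_circle hz)).div
      continuousOn_id fun z hz => ne_zero_of_mem_unit_circle hz) continuousOn_joukowsky
    fun z hz => (norm_joukowsky_le hs hz).trans hs1.le
  have h2 := key _ id (continuousOn_smallRoot_zpow hs hs1 l) continuousOn_id
    fun z hz => by simpa using (mem_sphere_zero_iff_norm.1 hz).le
  simp only [id, circleIntegral_smallRoot_zpow_mul_pow hs hs1] at h2
  exact h1.unique h2

lemma resolventIntegral_eq (hs : 0 < s) (hs1 : s < 1) (k : ℕ) (hω : ω ∈ sphere (0 : ℂ) 1) :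
    resolventIntegral s k ω =
      2 * (Real.pi : ℂ) * I * (smallRoot s ω⁻¹ ^ k / sqrtRatio s ω⁻¹) := by
  have h0 := ne_zero_of_mem_unit_circle hω
  have hs0 : (s : ℂ) ≠ 0 := ofReal_ne_zero.2 hs.ne'
  have hωi : ω⁻¹ ∈ sphere (0 : ℂ) 1 := by simpa using hω
  have hv0 := smallRoot_ne_zero hs hs1 hωi
  have hlt := norm_smallRoot_lt_one hs hs1 hωi
  have hj := joukowsky_smallRoot hs hs1 hωi
  rw [joukowsky] at hj
  have hdiff : -(ω * (I * s / 2)) * (smallRoot s ω⁻¹ - (smallRoot s ω⁻¹)⁻¹) =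
      sqrtRatio s ω⁻¹ := by
    rw [smallRoot_inv hs hs1 hωi, smallRoot]
    generalize sqrtRatio s ω⁻¹ = r
    field_simp
    linear_combination (-2 * r) * I_sq
  set v₀ := smallRoot s ω⁻¹
  have hσ : ω * (I * s / 2) * (v₀ + v₀⁻¹) = 1 := by
    rw [mul_assoc, hj, mul_inv_cancel₀ h0]
  have hσ0 : -(ω * (I * s / 2)) ≠ 0 := by simp [h0, hs0]
  have hne : ∀ v ∈ closedBall (0 : ℂ) 1, -(ω * (I * s / 2)) * (v - v₀⁻¹) ≠ 0 := by
    intro v hv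
    refine mul_ne_zero hσ0 (sub_ne_zero.2 ?_)
    rintro rfl
    rw [mem_closedBall_zero_iff, norm_inv] at hv
    exact absurd ((one_lt_inv₀ (norm_pos_iff.2 hv0)).2 hlt) (not_lt.2 hv)
  have hd : DiffContOnCl ℂ (fun v => v ^ k / (-(ω * (I * s / 2)) * (v - v₀⁻¹)))
      (ball (0 : ℂ) 1) := by
    refine DifferentiableOn.diffContOnCl ?_
    rw [closure_ball 0 one_ne_zero]
    exact (differentiableOn_id.pow k).div
      ((differentiableOn_id.sub_const _).const_mul _) hne
  have hc := hd.circleIntegral_sub_inv_smul (w := v₀) (by simpa using hlt)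
  rw [hdiff, smul_eq_mul] at hc
  rw [← hc, resolventIntegral]
  refine circleIntegral.integral_congr zero_le_one fun v hv => ?_
  have hv1 := ne_zero_of_mem_unit_circle hv
  have hfac : v * (1 - ω * joukowsky s v) =
      (v - v₀) * (-(ω * (I * s / 2)) * (v - v₀⁻¹)) := by
    have e1 : v * (1 - ω * joukowsky s v) = v - ω * (I * s / 2) * (v ^ 2 + 1) := by
      rw [joukowsky]
      field_simp
    have e2 : v₀ * v₀⁻¹ = 1 := mul_inv_cancel₀ hv0
    rw [e1]
    linear_combination (-v) * hσ + (ω * (I * s / 2)) * e2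
  simp only [smul_eq_mul]
  rw [div_mul_eq_mul_div, ← div_eq_mul_inv, div_div, mul_comm _ v, hfac, ← div_div,
    div_right_comm, div_eq_mul_inv _ (v - v₀), mul_comm]

end Aux

/-- For all integers `k, ℓ` with `k ≥ 0`, the double contour integral
`E_{k,ℓ}` equals the single contour integral
`i^{-k-ℓ}(2(1+a²))⁻¹(2πi)⁻¹ ∮_{|ω|=1} G(ω)^ℓ G(1/ω)^k / (ω·√(ω²+2c)·√(ω⁻²+2c)) dω`. -/
theorem statement16 (a : ℝ) (ha0 : 0 < a) (ha1 : a < 1) (k l : ℤ) (hk : 0 ≤ k) :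
    EE a k l =
      Complex.I ^ (-k - l) * (2 * (1 + (a : ℂ) ^ 2))⁻¹ * (2 * (Real.pi : ℂ) * Complex.I)⁻¹ *
        ∮ ω in C(0, 1), Gbr a ω ^ l * Gbr a ω⁻¹ ^ k / (ω * sqBr a ω * sqBr a ω⁻¹) := by
  obtain ⟨k, rfl⟩ := Int.eq_ofNat_of_zero_le hk
  have hq : 0 < 1 + a ^ 2 := by positivity
  have hc0 : 0 < 2 * cOf a := by
    rw [cOf]
    positivity
  have hc1 : 2 * cOf a < 1 := by
    rw [cOf, ← mul_div_assoc, div_lt_one hq]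
    nlinarith [sq_pos_of_pos (sub_pos.2 ha1)]
  have hsq : (Real.sqrt (2 * cOf a) : ℂ) ^ 2 * (1 + (a : ℂ) ^ 2) = 2 * a := by
    have : Real.sqrt (2 * cOf a) ^ 2 * (1 + a ^ 2) = 2 * a := by
      rw [Real.sq_sqrt hc0.le, cOf]
      field_simp
    exact_mod_cast congrArg (fun x : ℝ => (x : ℂ)) this
  have hs : 0 < Real.sqrt (2 * cOf a) := Real.sqrt_pos.2 hc0
  have hs1 : Real.sqrt (2 * cOf a) < 1 := by
    rw [Real.sqrt_lt' one_pos]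
    simpa using hc1
  have hsqBr (ω : ℂ) (hω : ω ∈ Metric.sphere (0 : ℂ) 1) :
      sqBr a ω = ω * sqrtRatio (Real.sqrt (2 * cOf a)) ω := exp_half_Lbr_add hs hs1 hω
  have hG (ω : ℂ) (hω : ω ∈ Metric.sphere (0 : ℂ) 1) :
      Gbr a ω = Complex.I * smallRoot (Real.sqrt (2 * cOf a)) ω := by
    rw [Gbr, hsqBr ω hω, smallRoot]
    linear_combination
      (ω * (1 - sqrtRatio (Real.sqrt (2 * cOf a)) ω) / (Real.sqrt (2 * cOf a) : ℂ)) * Complex.I_sq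
  set s := Real.sqrt (2 * cOf a)
  have hK : (1 + (a : ℂ) ^ 2) ≠ 0 := by exact_mod_cast hq.ne'
  have hpi : 2 * (Real.pi : ℂ) * Complex.I ≠ 0 := Complex.two_pi_I_ne_zero
  have hcc (u v : ℂ) :
      ccheck a u v = 2 * (1 + (a : ℂ) ^ 2) * (1 - joukowsky s u * joukowsky s v) := by
    rw [ccheck, joukowsky, joukowsky]
    linear_combination (-(u + u⁻¹) * (v + v⁻¹) / 2) * hsq +
      ((1 + (a : ℂ) ^ 2) * (s : ℂ) ^ 2 * (u + u⁻¹) * (v + v⁻¹) / 2) * Complex.I_sq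
  have hL : (∮ u in C(0, 1), ∮ v in C(0, 1), u ^ l * v ^ (k : ℤ) / (ccheck a u v * u * v)) =
      (2 * (1 + (a : ℂ) ^ 2))⁻¹ *
        ∮ u in C(0, 1), u ^ l / u * resolventIntegral s k (joukowsky s u) := by
    rw [← circleIntegral.integral_const_mul]
    congr 1
    funext u
    rw [resolventIntegral, ← circleIntegral.integral_const_mul,
      ← circleIntegral.integral_const_mul]
    congr 1
    funext v
    rw [hcc, zpow_natCast]
    simp only [div_eq_mul_inv, mul_inv]
    ring
  have hR : (∮ ω in C(0, 1), smallRoot s ω ^ l / (ω * sqrtRatio s ω) * resolventIntegral s k ω) =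
      2 * (Real.pi : ℂ) * Complex.I * Complex.I ^ (-(k : ℤ) - l) *
        ∮ ω in C(0, 1), Gbr a ω ^ l * Gbr a ω⁻¹ ^ (k : ℤ) / (ω * sqBr a ω * sqBr a ω⁻¹) := by
    rw [← circleIntegral.integral_const_mul]
    refine circleIntegral.integral_congr zero_le_one fun ω hω => ?_
    have hωi : ω⁻¹ ∈ Metric.sphere (0 : ℂ) 1 := by simpa using hω
    have h0 := ne_zero_of_mem_unit_circle hω
    have hI : Complex.I ^ (-(k : ℤ) - l) * (Complex.I ^ l * Complex.I ^ (k : ℤ)) = 1 := by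
      rw [← zpow_add₀ Complex.I_ne_zero, ← zpow_add₀ Complex.I_ne_zero,
        show -(k : ℤ) - l + (l + (k : ℤ)) = 0 by ring, zpow_zero]
    rw [resolventIntegral_eq hs hs1 k hω, hG ω hω, hG _ hωi, hsqBr ω hω, hsqBr _ hωi, mul_zpow,
      mul_zpow, zpow_natCast (smallRoot s ω⁻¹)]
    have hden : ω * (ω * sqrtRatio s ω) * (ω⁻¹ * sqrtRatio s ω⁻¹) =
        ω * sqrtRatio s ω * sqrtRatio s ω⁻¹ := by
      field_simp
    rw [hden]
    linear_combination (-(2 * (Real.pi : ℂ) * Complex.I * (smallRoot s ω ^ l * smallRoot s ω⁻¹ ^ k /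
      (ω * sqrtRatio s ω * sqrtRatio s ω⁻¹)))) * hI
  rw [EE, hL, circleIntegral_mul_resolventIntegral hs hs1, hR]
  field_simp
end
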